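/- For natural numbers k, ℓ, the number of triples (σ₁, σ₂, σ₃) of 0,1 strings of length k+ℓ, each with exactly k ones, such that σ₁ dominates σ₂ and σ₂ dominates σ₃ in the strict sense corresponding to non-intersecting shifted lattice paths (i.e., for every j, the prefix-count of ones of σ₁ up to j is ≥ that of σ₂, which is ≥ that of σ₃), counted with the appropriate strictness, equals Θ_{k,ℓ} = 2·(k+ℓ)!·(k+ℓ+1)!·(k+ℓ+2)!/(k!·(k+1)!·(k+2)!·ℓ!·(ℓ+1)!·(ℓ+2)!). Equivalently: the number of triples (P₁,P₂,P₃) of pairwise non-intersecting upright lattice paths with P₁ from (0,2) to (ℓ,k+2), P₂ from (1,1) to (ℓ+1,k+1), P₃ from (2,0) to (ℓ+2,k) equals Θ_{k,ℓ}. -/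

import Mathlib

/-- An upright lattice path with `m` unit steps `(1,0)` or `(0,1)`, from `s` to `t`,
recorded as the sequence of its `m+1` visited points. -/
def IsPathN (m : ℕ) (s t : ℕ × ℕ) (p : Fin (m + 1) → ℕ × ℕ) : Prop :=
  p 0 = s ∧ p (Fin.last m) = t ∧
    ∀ i : Fin m, p i.succ = p i.castSucc + (1, 0) ∨ p i.succ = p i.castSucc + (0, 1)

/-- Two paths are non-intersecting if they share no point. -/
def Noninter {m : ℕ} (p q : Fin (m + 1) → ℕ × ℕ) : Prop := ∀ i j, p i ≠ q j

/-- `Θ_{k,ℓ} = 2·(k+ℓ)!·(k+ℓ+1)!·(k+ℓ+2)! / (k!·(k+1)!·(k+2)!·ℓ!·(ℓ+1)!·(ℓ+2)!)`. -/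
def theta (k ℓ : ℕ) : ℚ :=
  2 * (k + ℓ).factorial * (k + ℓ + 1).factorial * (k + ℓ + 2).factorial /
    (k.factorial * (k + 1).factorial * (k + 2).factorial *
      ℓ.factorial * (ℓ + 1).factorial * (ℓ + 2).factorial)

/-- Walks of length `n` from `s` to `v`, where `pred v` is the finite set of predecessors of `v`. -/
def NWalk {α : Type} (pred : α → Finset α) (s : α) (n : ℕ) (v : α) : Type :=
  {q : Fin (n + 1) → α // q 0 = s ∧ q (Fin.last n) = v ∧
    ∀ i : Fin n, q i.castSucc ∈ pred (q i.succ)}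

/-- Removing the last vertex of a walk. -/
def nwalkEquiv {α : Type} (pred : α → Finset α) (s : α) (n : ℕ) (v : α) :
    NWalk pred s (n + 1) v ≃ Σ u : {u // u ∈ pred v}, NWalk pred s n u.1 where
  toFun q := ⟨⟨q.1 (Fin.last n).castSucc, by
      have h := q.2.2.2 (Fin.last n)
      rwa [Fin.succ_last, q.2.2.1] at h⟩,
    ⟨fun i => q.1 i.castSucc, q.2.1, rfl, fun i => q.2.2.2 i.castSucc⟩⟩
  invFun p := ⟨Fin.snoc (α := fun _ => α) p.2.1 v, by
      have h : (0 : Fin (n + 2)) = (0 : Fin (n + 1)).castSucc := rfl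
      rw [h, Fin.snoc_castSucc]; exact p.2.2.1, by simp, by
      intro i
      rw [Fin.snoc_castSucc]
      induction i using Fin.lastCases with
      | last => rw [Fin.succ_last, Fin.snoc_last, p.2.2.2.1]; exact p.1.2
      | cast i =>
        rw [Fin.succ_castSucc, Fin.snoc_castSucc]; exact p.2.2.2.2 i⟩
  left_inv q := by
    apply Subtype.ext
    funext i
    induction i using Fin.lastCases with
    | last => simp only [Fin.snoc_last]; exact q.2.2.1.symm
    | cast i => simp only [Fin.snoc_castSucc]
  right_inv p := by
    obtain ⟨⟨u, hu⟩, ⟨p, h0, h1, h2⟩⟩ := p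
    dsimp only at h1
    subst h1
    have gen : ∀ (u u' : {u // u ∈ pred v}) (w : NWalk pred s n u.1) (w' : NWalk pred s n u'.1),
        u = u' → w.1 = w'.1 →
        (⟨u, w⟩ : Σ u : {u // u ∈ pred v}, NWalk pred s n u.1) = ⟨u', w'⟩ := by
      intro u u' w w' h h'
      subst h
      rw [Subtype.ext h']
    apply gen
    · apply Subtype.ext
      simp only [Fin.snoc_castSucc]
    · funext i
      simp only [Fin.snoc_castSucc]

lemma nwalk_finite {α : Type} (pred : α → Finset α) (s : α) (n : ℕ) :
    ∀ v, Finite (NWalk pred s n v) := by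
  induction n with
  | zero =>
    intro v
    have : Subsingleton (NWalk pred s 0 v) := by
      refine ⟨fun a b => Subtype.ext (funext fun i => ?_)⟩
      have hi : i = 0 := Fin.ext (by omega)
      rw [hi, a.2.1, b.2.1]
    infer_instance
  | succ n ih =>
    intro v
    have := ih
    exact Finite.of_equiv _ (nwalkEquiv pred s n v).symm

lemma nwalk_card_succ {α : Type} (pred : α → Finset α) (s : α) (n : ℕ) (v : α) :
    Nat.card (NWalk pred s (n + 1) v) = ∑ u ∈ pred v, Nat.card (NWalk pred s n u) := by
  have := nwalk_finite pred s n
  rw [Nat.card_congr (nwalkEquiv pred s n v), Nat.card_sigma]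
  exact Finset.sum_coe_sort (pred v) (fun u => Nat.card (NWalk pred s n u))

/-- Predecessors of a lattice point. -/
def ptPred (p : ℕ × ℕ) : Finset (ℕ × ℕ) :=
  (if p.1 = 0 then ∅ else {(p.1 - 1, p.2)}) ∪ (if p.2 = 0 then ∅ else {(p.1, p.2 - 1)})

lemma mem_ptPred (u p : ℕ × ℕ) : u ∈ ptPred p ↔ p = u + (1, 0) ∨ p = u + (0, 1) := by
  obtain ⟨a, b⟩ := u
  obtain ⟨x, y⟩ := p
  simp only [ptPred, Finset.mem_union, Prod.mk_add_mk, Prod.mk.injEq]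
  split_ifs <;> simp only [Finset.mem_singleton, Finset.notMem_empty, Prod.mk.injEq, false_or,
    or_false, false_iff] <;> omega

lemma sum_ptPred (x y m : ℕ) (hm : x + y = m + 1) (h : ℚ → ℚ) :
    ∑ p ∈ ptPred (x, y), (m.choose p.1 : ℚ) * h p.1
      = ((m + 1).choose x : ℚ) / (m + 1) * (y * h x + x * h (x - 1)) := by
  have hm0 : (m : ℚ) + 1 ≠ 0 := by positivity
  have e1 : (y : ℚ) * ((m + 1).choose x) = (m + 1) * m.choose x := by
    have := Nat.choose_mul_succ_eq m x
    have hy : m + 1 - x = y := by omega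
    rw [hy] at this
    have h2 : ((m.choose x * (m + 1) : ℕ) : ℚ) = (((m + 1).choose x * y : ℕ) : ℚ) := by rw [this]
    push_cast at h2
    linarith
  have key : ∑ p ∈ ptPred (x, y), (m.choose p.1 : ℚ) * h p.1
      = (if x = 0 then 0 else (m.choose (x - 1) : ℚ) * h ((x : ℚ) - 1))
        + (if y = 0 then 0 else (m.choose x : ℚ) * h x) := by
    unfold ptPred
    rw [Finset.sum_union]
    · congr 1
      · by_cases hx : x = 0
        · simp [hx]
        · obtain ⟨z, rfl⟩ := Nat.exists_eq_succ_of_ne_zero hx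
          simp
      · by_cases hy : y = 0 <;> simp [hy]
    · rw [Finset.disjoint_left]
      intro a
      dsimp only
      split_ifs <;> simp only [Finset.mem_singleton, Finset.notMem_empty, Prod.ext_iff,
        not_false_eq_true, implies_true, false_implies] <;> omega
  rw [key]
  have t2 : (if y = 0 then 0 else (m.choose x : ℚ) * h x)
      = ((m + 1).choose x : ℚ) / (m + 1) * (y * h x) := by
    have : ((m + 1).choose x : ℚ) / (m + 1) * (y * h x) = m.choose x * h x := by
      field_simp
      linear_combination h x * e1
    rw [this]
    split_ifs with hy
    · have : m < x := by omega
      simp [Nat.choose_eq_zero_of_lt this]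
    · rfl
  have t1 : (if x = 0 then 0 else (m.choose (x - 1) : ℚ) * h ((x : ℚ) - 1))
      = ((m + 1).choose x : ℚ) / (m + 1) * (x * h (x - 1)) := by
    rcases x with _ | z
    · simp
    · have e2 : ((m : ℚ) + 1) * m.choose z = (m + 1).choose (z + 1) * (z + 1) := by
        exact_mod_cast Nat.add_one_mul_choose_eq m z
      simp only [Nat.add_one_ne_zero, if_false, Nat.add_sub_cancel]
      push_cast
      field_simp
      linear_combination h (z + 1 - 1) * e2
  rw [t1, t2]
  ring

/-- The state space: triples of lattice points. -/
abbrev Tri := (ℕ × ℕ) × (ℕ × ℕ) × (ℕ × ℕ)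

/-- Pairwise distinct predecessors of a triple. -/
def triPred (v : Tri) : Finset Tri :=
  (ptPred v.1 ×ˢ ptPred v.2.1 ×ˢ ptPred v.2.2).filter
    (fun u => u.1 ≠ u.2.1 ∧ u.1 ≠ u.2.2 ∧ u.2.1 ≠ u.2.2)

/-- The Vandermonde product. -/
def vdm (a b c : ℚ) : ℚ := (b - a) * (c - a) * (c - b)

lemma sum_tri (n : ℕ) (u v w : ℕ × ℕ) (hu : u.1 + u.2 = n + 3) (hv : v.1 + v.2 = n + 3)
    (hw : w.1 + w.2 = n + 3) :
    ∑ t ∈ ptPred u ×ˢ ptPred v ×ˢ ptPred w,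
      (vdm t.1.1 t.2.1.1 t.2.2.1 * (n + 2).choose t.1.1 * (n + 2).choose t.2.1.1
        * (n + 2).choose t.2.2.1 : ℚ)
      = (n + 1) * (n + 2) / (n + 3) ^ 2 * (vdm u.1 v.1 w.1 *
          (n + 3).choose u.1 * (n + 3).choose v.1 * (n + 3).choose w.1) := by
  obtain ⟨a, a'⟩ := u
  obtain ⟨b, b'⟩ := v
  obtain ⟨c, c'⟩ := w
  dsimp only at hu hv hw ⊢
  have A := fun h => sum_ptPred a a' (n + 2) hu h
  have B := fun h => sum_ptPred b b' (n + 2) hv h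
  have C := fun h => sum_ptPred c c' (n + 2) hw h
  set V1 : ℚ → ℚ → ℚ := fun x y => (((n + 2 : ℕ) + 1).choose c : ℚ) / ((n + 2 : ℕ) + 1) *
    (c' * vdm x y c + c * vdm x y (c - 1)) with hV1
  set V2 : ℚ → ℚ := fun x => (((n + 2 : ℕ) + 1).choose b : ℚ) / ((n + 2 : ℕ) + 1) *
    (b' * V1 x b + b * V1 x (b - 1)) with hV2
  have step : ∑ t ∈ ptPred (a, a') ×ˢ ptPred (b, b') ×ˢ ptPred (c, c'),
      (vdm t.1.1 t.2.1.1 t.2.2.1 * (n + 2).choose t.1.1 * (n + 2).choose t.2.1.1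
        * (n + 2).choose t.2.2.1 : ℚ) =
      ∑ p ∈ ptPred (a, a'), ((n + 2).choose p.1 : ℚ) * V2 p.1 := by
    rw [Finset.sum_product]
    refine Finset.sum_congr rfl fun p _ => ?_
    rw [hV2]
    dsimp only
    rw [← B (fun y => V1 p.1 y), Finset.sum_product, Finset.mul_sum]
    refine Finset.sum_congr rfl fun q _ => ?_
    rw [hV1]
    dsimp only
    rw [← C (fun z => vdm p.1 q.1 z), Finset.mul_sum, Finset.mul_sum]
    refine Finset.sum_congr rfl fun r _ => ?_
    ring
  rw [step, A V2, hV2, hV1]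
  have ha : (a' : ℚ) = n + 3 - a := by
    have : ((a + a' : ℕ) : ℚ) = ((n + 3 : ℕ) : ℚ) := by rw [hu]
    push_cast at this; linarith
  have hb : (b' : ℚ) = n + 3 - b := by
    have : ((b + b' : ℕ) : ℚ) = ((n + 3 : ℕ) : ℚ) := by rw [hv]
    push_cast at this; linarith
  have hc : (c' : ℚ) = n + 3 - c := by
    have : ((c + c' : ℕ) : ℚ) = ((n + 3 : ℕ) : ℚ) := by rw [hw]
    push_cast at this; linarith
  have e3 : n + 2 + 1 = n + 3 := rfl
  have e3q : ((n + 2 : ℕ) : ℚ) + 1 = n + 3 := by push_cast; ring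
  have h0 : (n : ℚ) + 3 ≠ 0 := by positivity
  simp only [e3, e3q, ha, hb, hc, vdm]
  field_simp
  ring

lemma card_tri (n : ℕ) : ∀ u v w : ℕ × ℕ, u.1 + u.2 = n + 2 → v.1 + v.2 = n + 2 →
    w.1 + w.2 = n + 2 → u.1 < v.1 → v.1 < w.1 →
    (Nat.card (NWalk triPred ((0, 2), (1, 1), (2, 0)) n (u, v, w)) : ℚ) =
      vdm u.1 v.1 w.1 * (n + 2).choose u.1 * (n + 2).choose v.1 * (n + 2).choose w.1
        / ((n + 1) * (n + 2) ^ 2) := by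
  induction n with
  | zero =>
    rintro ⟨a, a'⟩ ⟨b, b'⟩ ⟨c, c'⟩ hu hv hw h1 h2
    dsimp only at hu hv hw h1 h2
    obtain rfl : a = 0 := by omega
    obtain rfl : b = 1 := by omega
    obtain rfl : c = 2 := by omega
    obtain rfl : a' = 2 := by omega
    obtain rfl : b' = 1 := by omega
    obtain rfl : c' = 0 := by omega
    have : Nat.card (NWalk triPred ((0, 2), (1, 1), (2, 0)) 0 ((0, 2), (1, 1), (2, 0))) = 1 := by
      rw [Nat.card_eq_one_iff_unique]
      constructor
      · refine ⟨fun a b => Subtype.ext (funext fun i => ?_)⟩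
        have hi : i = 0 := Fin.ext (by omega)
        rw [hi, a.2.1, b.2.1]
      · exact ⟨⟨fun _ => ((0, 2), (1, 1), (2, 0)), rfl, rfl, fun i => i.elim0⟩⟩
    rw [this]
    norm_num [vdm, Nat.choose]
  | succ n ih =>
    intro u v w hu hv hw h1 h2
    rw [nwalk_card_succ]
    push_cast
    have hs := sum_tri n u v w (by omega) (by omega) (by omega)
    have mem : ∀ {p q : ℕ × ℕ}, p ∈ ptPred q →
        p.1 + p.2 + 1 = q.1 + q.2 ∧ p.1 ≤ q.1 ∧ q.1 ≤ p.1 + 1 := by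
      rintro ⟨x, y⟩ ⟨z, t⟩ h
      rw [mem_ptPred] at h
      simp only [Prod.mk_add_mk, Prod.mk.injEq] at h
      dsimp only
      omega
    have : ∑ t ∈ triPred (u, v, w),
        (Nat.card (NWalk triPred ((0, 2), (1, 1), (2, 0)) n t) : ℚ) =
        ∑ t ∈ ptPred u ×ˢ ptPred v ×ˢ ptPred w,
      (vdm t.1.1 t.2.1.1 t.2.2.1 * (n + 2).choose t.1.1 * (n + 2).choose t.2.1.1
        * (n + 2).choose t.2.2.1 : ℚ) / ((n + 1) * (n + 2) ^ 2) := by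
      unfold triPred
      rw [Finset.sum_filter]
      refine Finset.sum_congr rfl ?_
      rintro ⟨p, q, r⟩ ht
      simp only [Finset.mem_product] at ht
      have m1 := mem ht.1
      have m2 := mem ht.2.1
      have m3 := mem ht.2.2
      dsimp only
      split_ifs with hd
      · have d1 : p.1 ≠ q.1 := fun h => hd.1 (Prod.ext h (by omega))
        have d3 : q.1 ≠ r.1 := fun h => hd.2.2 (Prod.ext h (by omega))
        exact ih p q r (by omega) (by omega) (by omega) (by omega) (by omega)
      · have : p.1 = q.1 ∨ p.1 = r.1 ∨ q.1 = r.1 := by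
          by_contra hcon
          push Not at hcon
          exact hd ⟨fun h => hcon.1 (by rw [h]), fun h => hcon.2.1 (by rw [h]),
            fun h => hcon.2.2 (by rw [h])⟩
        have hz : vdm p.1 q.1 r.1 = 0 := by
          rcases this with h | h | h <;> simp [vdm, h]
        rw [hz]; simp
    rw [this, ← Finset.sum_div, hs]
    have e : n + 1 + 2 = n + 3 := rfl
    rw [e]
    have p1 : (n : ℚ) + 1 ≠ 0 := by positivity
    have p2 : (n : ℚ) + 2 ≠ 0 := by positivity
    have p3 : (n : ℚ) + 3 ≠ 0 := by positivity
    have q2 : (n : ℚ) + 1 + 1 = n + 2 := by ring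
    have q3 : (n : ℚ) + 1 + 2 = n + 3 := by ring
    rw [q2, q3]
    field_simp

lemma path_sum {m : ℕ} {s t : ℕ × ℕ} {p : Fin (m + 1) → ℕ × ℕ} (h : IsPathN m s t p)
    (i : Fin (m + 1)) : (p i).1 + (p i).2 = s.1 + s.2 + i := by
  induction i using Fin.induction with
  | zero => simp [h.1]
  | succ i ih =>
    rcases h.2.2 i with e | e <;> rw [e] <;> simp at ih ⊢ <;> omega

lemma noninter_iff {m : ℕ} {s t s' t' : ℕ × ℕ} {p q : Fin (m + 1) → ℕ × ℕ}
    (h : IsPathN m s t p) (h' : IsPathN m s' t' q) (hs : s.1 + s.2 = s'.1 + s'.2) :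
    Noninter p q ↔ ∀ i, p i ≠ q i := by
  refine ⟨fun H i => H i i, fun H i j e => ?_⟩
  have h1 := path_sum h i
  have h2 := path_sum h' j
  rw [e] at h1
  have : i = j := Fin.ext (by omega)
  subst this
  exact H i e

/-- Triples of sequences are sequences of triples. -/
def triEquiv (I : Type) :
    ((I → ℕ × ℕ) × (I → ℕ × ℕ) × (I → ℕ × ℕ)) ≃ (I → Tri) where
  toFun t i := (t.1 i, t.2.1 i, t.2.2 i)
  invFun q := (fun i => (q i).1, fun i => (q i).2.1, fun i => (q i).2.2)
  left_inv _ := rfl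
  right_inv _ := rfl

lemma card_eq (k ℓ : ℕ) :
    Nat.card {t : (Fin (k + ℓ + 1) → ℕ × ℕ) × (Fin (k + ℓ + 1) → ℕ × ℕ) ×
          (Fin (k + ℓ + 1) → ℕ × ℕ) //
        IsPathN (k + ℓ) (0, 2) (ℓ, k + 2) t.1 ∧
        IsPathN (k + ℓ) (1, 1) (ℓ + 1, k + 1) t.2.1 ∧
        IsPathN (k + ℓ) (2, 0) (ℓ + 2, k) t.2.2 ∧
        Noninter t.1 t.2.1 ∧ Noninter t.1 t.2.2 ∧ Noninter t.2.1 t.2.2} =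
    Nat.card (NWalk triPred ((0, 2), (1, 1), (2, 0)) (k + ℓ)
      ((ℓ, k + 2), (ℓ + 1, k + 1), (ℓ + 2, k))) := by
  refine Nat.card_congr (Equiv.subtypeEquiv (triEquiv _) ?_)
  rintro ⟨p, q, r⟩
  simp only [triEquiv, Equiv.coe_fn_mk, triPred, Finset.mem_filter, Finset.mem_product,
    mem_ptPred, Prod.mk.injEq]
  constructor
  · rintro ⟨hp, hq, hr, h1, h2, h3⟩
    exact ⟨⟨hp.1, hq.1, hr.1⟩, ⟨hp.2.1, hq.2.1, hr.2.1⟩, fun i =>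
      ⟨⟨hp.2.2 i, hq.2.2 i, hr.2.2 i⟩, h1 _ _, h2 _ _, h3 _ _⟩⟩
  · rintro ⟨⟨a1, a2, a3⟩, ⟨b1, b2, b3⟩, h⟩
    have hp : IsPathN (k + ℓ) (0, 2) (ℓ, k + 2) p := ⟨a1, b1, fun i => (h i).1.1⟩
    have hq : IsPathN (k + ℓ) (1, 1) (ℓ + 1, k + 1) q := ⟨a2, b2, fun i => (h i).1.2.1⟩
    have hr : IsPathN (k + ℓ) (2, 0) (ℓ + 2, k) r := ⟨a3, b3, fun i => (h i).1.2.2⟩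
    refine ⟨hp, hq, hr, ?_⟩
    rw [noninter_iff hp hq rfl, noninter_iff hp hr rfl, noninter_iff hq hr rfl]
    refine ⟨fun i => ?_, fun i => ?_, fun i => ?_⟩ <;>
      induction i using Fin.lastCases with
      | last => simp [b1, b2, b3]
      | cast i => first | exact (h i).2.1 | exact (h i).2.2.1 | exact (h i).2.2.2

theorem noninter_triples_theta (k ℓ : ℕ) :
    (Nat.card {t : (Fin (k + ℓ + 1) → ℕ × ℕ) × (Fin (k + ℓ + 1) → ℕ × ℕ) ×
          (Fin (k + ℓ + 1) → ℕ × ℕ) //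
        IsPathN (k + ℓ) (0, 2) (ℓ, k + 2) t.1 ∧
        IsPathN (k + ℓ) (1, 1) (ℓ + 1, k + 1) t.2.1 ∧
        IsPathN (k + ℓ) (2, 0) (ℓ + 2, k) t.2.2 ∧
        Noninter t.1 t.2.1 ∧ Noninter t.1 t.2.2 ∧ Noninter t.2.1 t.2.2} : ℚ)
      = theta k ℓ := by
  rw [card_eq, card_tri (k + ℓ) _ _ _ (by dsimp only; omega) (by dsimp only; omega)
    (by dsimp only; omega) (by dsimp only; omega) (by dsimp only; omega)]
  dsimp only
  have c1 : ((k + ℓ + 2).choose ℓ : ℚ) =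
      (k + ℓ + 2).factorial / (ℓ.factorial * (k + 2).factorial) := by
    rw [Nat.cast_choose ℚ (by omega), show k + ℓ + 2 - ℓ = k + 2 by omega]
  have c2 : ((k + ℓ + 2).choose (ℓ + 1) : ℚ) =
      (k + ℓ + 2).factorial / ((ℓ + 1).factorial * (k + 1).factorial) := by
    rw [Nat.cast_choose ℚ (by omega), show k + ℓ + 2 - (ℓ + 1) = k + 1 by omega]
  have c3 : ((k + ℓ + 2).choose (ℓ + 2) : ℚ) =
      (k + ℓ + 2).factorial / ((ℓ + 2).factorial * k.factorial) := by
    rw [Nat.cast_choose ℚ (by omega), show k + ℓ + 2 - (ℓ + 2) = k by omega]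
  have f1 : ((k + ℓ + 1).factorial : ℚ) = (k + ℓ + 1) * (k + ℓ).factorial := by
    rw [Nat.factorial_succ]; push_cast; ring
  have f2 : ((k + ℓ + 2).factorial : ℚ) = (k + ℓ + 2) * ((k + ℓ + 1) * (k + ℓ).factorial) := by
    rw [Nat.factorial_succ, Nat.cast_mul, f1]; push_cast; ring
  have hv : vdm (ℓ : ℚ) ((ℓ + 1 : ℕ) : ℚ) ((ℓ + 2 : ℕ) : ℚ) = 2 := by
    unfold vdm; push_cast; ring
  rw [c1, c2, c3, hv, theta, f1, f2]
  have z := fun n => (Nat.cast_ne_zero (R := ℚ)).2 (Nat.factorial_ne_zero n)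
  have z1 := z k
  have z2 := z (k + 1)
  have z3 := z (k + 2)
  have z4 := z ℓ
  have z5 := z (ℓ + 1)
  have z6 := z (ℓ + 2)
  have p1 : (k : ℚ) + ℓ + 1 ≠ 0 := by positivity
  have p2 : (k : ℚ) + ℓ + 2 ≠ 0 := by positivity
  push_cast
  field_simp
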